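/- Let K, L be convex bodies in ℝ^n with the same centroid. Then vol(K)·vol(L) ≤ vol(K − L)·vol(K ∩ L), where K − L = {x − y : x ∈ K, y ∈ L} is the Minkowski difference. -/

import Mathlib

open MeasureTheory Pointwise

/-- One-dimensional Brunn–Minkowski inequality for compact sets. -/
theorem volume_add_le_of_isCompact {A B C : Set ℝ} (hA : IsCompact A) (hB : IsCompact B)
    (hA0 : A.Nonempty) (hB0 : B.Nonempty) (h : A + B ⊆ C) :
    volume A + volume B ≤ volume C := by
  obtain ⟨α, hαA, hα⟩ := hA.exists_isGreatest hA0
  obtain ⟨β, hβB, hβ⟩ := hB.exists_isLeast hB0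
  have hm : MeasurableSet (α +ᵥ B) := (hB.vadd α).measurableSet
  have hinter : volume ((β +ᵥ A) ∩ (α +ᵥ B)) = 0 := by
    refine measure_mono_null (t := {α + β}) ?_ (by simp)
    rintro _ ⟨⟨x, hx, rfl⟩, y, hy, hxy⟩
    have h1 := hα hx
    have h2 := hβ hy
    simp only [vadd_eq_add, Set.mem_singleton_iff] at hxy ⊢
    linarith
  have hu := measure_union_add_inter (μ := (volume : Measure ℝ)) (β +ᵥ A) hm
  rw [hinter, add_zero, measure_vadd, measure_vadd] at hu
  rw [← hu]
  refine measure_mono (Set.union_subset ?_ ?_)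
  · rintro _ ⟨x, hx, rfl⟩
    exact h ⟨x, hx, β, hβB, by simp [add_comm]⟩
  · rintro _ ⟨x, hx, rfl⟩
    exact h ⟨α, hαA, x, hx, by simp⟩

/-- One-dimensional Brunn–Minkowski inequality. -/
theorem volume_add_le_of_add_subset {A B C : Set ℝ} (hA : MeasurableSet A) (hB : MeasurableSet B)
    (hA0 : A.Nonempty) (hB0 : B.Nonempty) (h : A + B ⊆ C) :
    volume A + volume B ≤ volume C := by
  have key : ∀ K ⊆ A, IsCompact K → ∀ L ⊆ B, IsCompact L → volume K + volume L ≤ volume C := by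
    intro K hKA hK L hLB hL
    obtain ⟨x, hx⟩ := hA0
    obtain ⟨y, hy⟩ := hB0
    calc volume K + volume L ≤ volume (insert x K) + volume (insert y L) := by
          gcongr <;> exact Set.subset_insert _ _
      _ ≤ volume C := volume_add_le_of_isCompact (hK.insert x) (hL.insert y)
          (Set.insert_nonempty _ _) (Set.insert_nonempty _ _)
          ((Set.add_subset_add (Set.insert_subset hx hKA) (Set.insert_subset hy hLB)).trans h)
  rw [hA.measure_eq_iSup_isCompact, hB.measure_eq_iSup_isCompact]
  simp only [iSup_and']
  exact ENNReal.biSup_add_biSup_le' ⟨∅, Set.empty_subset _, isCompact_empty⟩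
    ⟨∅, Set.empty_subset _, isCompact_empty⟩ fun K hK L hL => key K hK.1 hK.2 L hL.1 hL.2

theorem volume_weighted_add_le {A B C : Set ℝ} {a b : ℝ} (ha : 0 < a) (hb : 0 < b)
    (hA : MeasurableSet A) (hB : MeasurableSet B) (hA0 : A.Nonempty) (hB0 : B.Nonempty)
    (h : ∀ x ∈ A, ∀ y ∈ B, a * x + b * y ∈ C) :
    ENNReal.ofReal a * volume A + ENNReal.ofReal b * volume B ≤ volume C := by
  have hs : ∀ {c : ℝ}, 0 < c → ∀ S : Set ℝ, ENNReal.ofReal c * volume S = volume (c • S) := by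
    intro c hc S
    simp [Measure.addHaar_smul, abs_of_pos hc]
  rw [hs ha, hs hb]
  refine volume_add_le_of_add_subset (hA.const_smul_of_ne_zero ha.ne')
    (hB.const_smul_of_ne_zero hb.ne') hA0.smul_set hB0.smul_set ?_
  rintro _ ⟨_, ⟨x, hx, rfl⟩, _, ⟨y, hy, rfl⟩, rfl⟩
  exact h x hx y hy

theorem ENNReal.rpow_mul_rpow_le_weighted_add {a b : ℝ} (ha : 0 < a) (hb : 0 < b)
    (hab : a + b = 1) (x y : ENNReal) :
    x ^ a * y ^ b ≤ ENNReal.ofReal a * x + ENNReal.ofReal b * y := by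
  by_cases hx : x = ⊤
  · simp [hx, ENNReal.mul_top, ha]
  by_cases hy : y = ⊤
  · simp [hy, ENNReal.mul_top, hb]
  lift x to NNReal using hx
  lift y to NNReal using hy
  lift a to NNReal using ha.le
  lift b to NNReal using hb.le
  have := NNReal.geom_mean_le_arith_mean2_weighted a b x y (by exact_mod_cast hab)
  rw [← ENNReal.coe_rpow_of_nonneg x ha.le, ← ENNReal.coe_rpow_of_nonneg y hb.le,
    ENNReal.ofReal_coe_nnreal, ENNReal.ofReal_coe_nnreal]
  exact_mod_cast this

/-- The layer-cake formula for a function with values in `[0, 1]`. -/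
theorem lintegral_ofReal_eq_lintegral_Ioo {f : ℝ → ℝ} (hf : Measurable f) (h0 : ∀ x, 0 ≤ f x)
    (h1 : ∀ x, f x ≤ 1) :
    ∫⁻ x, ENNReal.ofReal (f x) = ∫⁻ t in Set.Ioo (0 : ℝ) 1, volume {x | t < f x} := by
  rw [lintegral_eq_lintegral_meas_lt _ (.of_forall h0) hf.aemeasurable]
  rw [← Set.Ioo_union_Ici_eq_Ioi (zero_lt_one' ℝ), lintegral_union measurableSet_Ici
    (Set.disjoint_left.2 fun x hx hx' => absurd hx.2 (not_lt.2 hx'))]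
  rw [setLIntegral_congr_fun (g := 0) measurableSet_Ici]
  · simp
  · intro t ht
    have : {x | t < f x} = ∅ := by
      ext x
      simpa using (h1 x).trans ht
    simp [this]

/-- The Prékopa–Leindler inequality on the line for functions with supremum one. -/
theorem prekopa_leindler_real_normalized {f g h : ℝ → ℝ} {a b : ℝ} (ha : 0 < a) (hb : 0 < b)
    (hab : a + b = 1) (hf : Measurable f) (hg : Measurable g) (hh : Measurable h)
    (hf0 : ∀ x, 0 ≤ f x) (hg0 : ∀ x, 0 ≤ g x) (hh0 : ∀ x, 0 ≤ h x)
    (hf1 : ∀ x, f x ≤ 1) (hg1 : ∀ x, g x ≤ 1)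
    (hfs : ∀ t < 1, ∃ x, t < f x) (hgs : ∀ t < 1, ∃ x, t < g x)
    (H : ∀ x y, f x ^ a * g y ^ b ≤ h (a * x + b * y)) :
    (∫⁻ x, ENNReal.ofReal (f x)) ^ a * (∫⁻ x, ENNReal.ofReal (g x)) ^ b ≤
      ∫⁻ x, ENNReal.ofReal (h x) := by
  refine (ENNReal.rpow_mul_rpow_le_weighted_add ha hb hab _ _).trans ?_
  rw [lintegral_ofReal_eq_lintegral_Ioo hf hf0 hf1, lintegral_ofReal_eq_lintegral_Ioo hg hg0 hg1,
    lintegral_eq_lintegral_meas_lt _ (.of_forall hh0) hh.aemeasurable,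
    ← lintegral_const_mul' _ _ ENNReal.ofReal_ne_top,
    ← lintegral_const_mul' _ _ ENNReal.ofReal_ne_top, ← lintegral_add_left]
  · refine le_trans ?_ (lintegral_mono_set (s := Set.Ioo (0 : ℝ) 1) Set.Ioo_subset_Ioi_self)
    refine setLIntegral_mono' measurableSet_Ioo fun t ht => ?_
    refine volume_weighted_add_le ha hb (measurableSet_lt measurable_const hf)
      (measurableSet_lt measurable_const hg) (hfs t ht.2) (hgs t ht.2) fun x hx y hy => ?_
    calc t = t ^ a * t ^ b := by rw [← Real.rpow_add ht.1, hab, Real.rpow_one]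
      _ < f x ^ a * g y ^ b := mul_lt_mul'' (Real.rpow_lt_rpow ht.1.le hx ha)
          (Real.rpow_lt_rpow ht.1.le hy hb) (Real.rpow_nonneg ht.1.le _)
          (Real.rpow_nonneg ht.1.le _)
      _ ≤ _ := H x y
  · refine Measurable.const_mul (Antitone.measurable fun s t hst => ?_) _
    exact measure_mono fun x hx => lt_of_le_of_lt hst hx

/-- The Prékopa–Leindler inequality on the line for bounded functions. -/
theorem prekopa_leindler_real {f g h : ℝ → ℝ} {a b : ℝ} (ha : 0 < a) (hb : 0 < b)
    (hab : a + b = 1) (hf : Measurable f) (hg : Measurable g) (hh : Measurable h)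
    (hf0 : ∀ x, 0 ≤ f x) (hg0 : ∀ x, 0 ≤ g x) (hh0 : ∀ x, 0 ≤ h x)
    (hfb : BddAbove (Set.range f)) (hgb : BddAbove (Set.range g))
    (H : ∀ x y, f x ^ a * g y ^ b ≤ h (a * x + b * y)) :
    (∫⁻ x, ENNReal.ofReal (f x)) ^ a * (∫⁻ x, ENNReal.ofReal (g x)) ^ b ≤
      ∫⁻ x, ENNReal.ofReal (h x) := by
  by_cases hfz : ∀ x, f x = 0
  · simp [hfz, ha]
  by_cases hgz : ∀ x, g x = 0
  · simp [hgz, hb]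
  push Not at hfz hgz
  have hpos : ∀ {u : ℝ → ℝ}, (∀ x, 0 ≤ u x) → BddAbove (Set.range u) → (∃ x, u x ≠ 0) →
      0 < ⨆ x, u x := fun h0 hb ⟨x, hx⟩ =>
    ((h0 x).lt_of_ne' hx).trans_le (le_ciSup hb x)
  have hF := hpos hf0 hfb hfz
  have hG := hpos hg0 hgb hgz
  set F := ⨆ x, f x with hFdef
  set G := ⨆ x, g x with hGdef
  have hFa := Real.rpow_pos_of_pos hF a
  have hGb := Real.rpow_pos_of_pos hG b
  have hsup : ∀ {u : ℝ → ℝ}, 0 < ⨆ x, u x → ∀ t < (1 : ℝ), ∃ x, t < u x / ⨆ x, u x := by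
    intro u hu t ht
    obtain ⟨x, hx⟩ := exists_lt_of_lt_ciSup (show t * (⨆ x, u x) < ⨆ x, u x by nlinarith)
    exact ⟨x, (lt_div_iff₀ hu).2 hx⟩
  have key := prekopa_leindler_real_normalized (f := fun x => f x / F) (g := fun x => g x / G)
    (h := fun x => h x / (F ^ a * G ^ b)) ha hb hab (hf.div_const _) (hg.div_const _)
    (hh.div_const _) (fun x => div_nonneg (hf0 x) hF.le) (fun x => div_nonneg (hg0 x) hG.le)
    (fun x => div_nonneg (hh0 x) (by positivity))
    (fun x => (div_le_one hF).2 (le_ciSup hfb x)) (fun x => (div_le_one hG).2 (le_ciSup hgb x))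
    (hsup hF) (hsup hG) (fun x y => by
      rw [Real.div_rpow (hf0 x) hF.le, Real.div_rpow (hg0 y) hG.le, div_mul_div_comm]
      gcongr
      exact H x y)
  have hscale : ∀ {u : ℝ → ℝ} {c : ℝ}, 0 < c → Measurable u → ∫⁻ x, ENNReal.ofReal (u x) =
      ENNReal.ofReal c * ∫⁻ x, ENNReal.ofReal (u x / c) := by
    intro u c hc hu
    rw [← lintegral_const_mul _ (by fun_prop)]
    congr with x
    rw [← ENNReal.ofReal_mul hc.le, mul_div_cancel₀ _ hc.ne']
  rw [hscale hF hf, hscale hG hg, hscale (mul_pos hFa hGb) hh,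
    ENNReal.mul_rpow_of_nonneg _ _ ha.le, ENNReal.mul_rpow_of_nonneg _ _ hb.le,
    ENNReal.ofReal_rpow_of_pos hF, ENNReal.ofReal_rpow_of_pos hG, mul_mul_mul_comm,
    ← ENNReal.ofReal_mul hFa.le]
  gcongr

/-- A measure satisfies the multiplicative Brunn–Minkowski inequality (on bounded sets). -/
def BrunnMinkowski {E : Type*} [NormedAddCommGroup E] [NormedSpace ℝ E] [MeasurableSpace E]
    (μ : Measure E) : Prop :=
  ∀ ⦃a b : ℝ⦄, 0 < a → 0 < b → a + b = 1 → ∀ ⦃A B C : Set E⦄, MeasurableSet A → MeasurableSet B →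
    MeasurableSet C → Bornology.IsBounded A → Bornology.IsBounded B → Bornology.IsBounded C →
    (∀ x ∈ A, ∀ y ∈ B, a • x + b • y ∈ C) → μ A ^ a * μ B ^ b ≤ μ C

section BrunnMinkowski

variable {E F : Type*} [NormedAddCommGroup E] [NormedSpace ℝ E] [MeasurableSpace E]
  [NormedAddCommGroup F] [NormedSpace ℝ F] [MeasurableSpace F]

theorem BrunnMinkowski.of_subsingleton [Subsingleton E] {μ : Measure E} [IsProbabilityMeasure μ] :
    BrunnMinkowski μ := by
  intro a b ha hb _ A B C _ _ _ _ _ _ h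
  rcases A.eq_empty_or_nonempty with rfl | ⟨x, hx⟩
  · simp [ha]
  rcases B.eq_empty_or_nonempty with rfl | ⟨y, hy⟩
  · simp [hb]
  have hC : C = Set.univ := Set.eq_univ_of_forall fun z => Subsingleton.elim _ z ▸ h x hx y hy
  rw [hC, measure_univ]
  exact mul_le_one' (ENNReal.rpow_le_one prob_le_one ha.le) (ENNReal.rpow_le_one prob_le_one hb.le)

theorem BrunnMinkowski.of_measurePreserving {μ : Measure E} {ν : Measure F}
    (h : BrunnMinkowski μ) (e : E ≃L[ℝ] F) (he : MeasurePreserving e μ ν) : BrunnMinkowski ν := by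
  intro a b ha hb hab A B C hA hB hC hAb hBb hCb H
  have hbd : ∀ {S : Set F}, Bornology.IsBounded S → Bornology.IsBounded (e ⁻¹' S) := by
    intro S hS
    rw [← e.image_symm_eq_preimage]
    exact e.symm.lipschitz.isBounded_image hS
  rw [← he.measure_preimage hA.nullMeasurableSet, ← he.measure_preimage hB.nullMeasurableSet,
    ← he.measure_preimage hC.nullMeasurableSet]
  exact h ha hb hab (he.measurable hA) (he.measurable hB) (he.measurable hC) (hbd hAb) (hbd hBb)
    (hbd hCb) fun x hx y hy => by simpa using H _ hx _ hy

theorem BrunnMinkowski.prod_real [ProperSpace E] {μ : Measure E} [SFinite μ]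
    [IsFiniteMeasureOnCompacts μ] (h : BrunnMinkowski μ) :
    BrunnMinkowski ((volume : Measure ℝ).prod μ) := by
  intro a b ha hb hab A B C hA hB hC hAb hBb hCb H
  have hsec : ∀ {S : Set (ℝ × E)}, ∀ s : ℝ, Prod.mk s ⁻¹' S ⊆ Prod.snd '' S :=
    fun s x hx => ⟨(s, x), hx, rfl⟩
  have hbd : ∀ {S : Set (ℝ × E)}, Bornology.IsBounded S → ∀ s : ℝ,
      Bornology.IsBounded (Prod.mk s ⁻¹' S) := fun hS s => hS.image_snd.subset (hsec s)
  have hmono : ∀ {S : Set (ℝ × E)}, MeasurableSet S → Bornology.IsBounded S →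
      ((volume : Measure ℝ).prod μ) S = ∫⁻ s, ENNReal.ofReal (μ (Prod.mk s ⁻¹' S)).toReal := by
    intro S hS hSb
    rw [Measure.prod_apply hS]
    congr with s
    rw [ENNReal.ofReal_toReal (hbd hSb s).measure_lt_top.ne]
  have habove : ∀ {S : Set (ℝ × E)}, Bornology.IsBounded S →
      BddAbove (Set.range fun s : ℝ => (μ (Prod.mk s ⁻¹' S)).toReal) := by
    rintro S hS
    refine ⟨(μ (Prod.snd '' S)).toReal, ?_⟩
    rintro _ ⟨s, rfl⟩
    exact ENNReal.toReal_mono hS.image_snd.measure_lt_top.ne (measure_mono (hsec s))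
  rw [hmono hA hAb, hmono hB hBb, hmono hC hCb]
  refine prekopa_leindler_real ha hb hab (measurable_measure_prodMk_left hA).ennreal_toReal
    (measurable_measure_prodMk_left hB).ennreal_toReal
    (measurable_measure_prodMk_left hC).ennreal_toReal (fun _ => ENNReal.toReal_nonneg)
    (fun _ => ENNReal.toReal_nonneg) (fun _ => ENNReal.toReal_nonneg) (habove hAb) (habove hBb)
    fun s t => ?_
  rw [ENNReal.toReal_rpow, ENNReal.toReal_rpow, ← ENNReal.toReal_mul]
  refine ENNReal.toReal_mono (hbd hCb _).measure_lt_top.ne ?_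
  refine h ha hb hab (measurable_prodMk_left hA) (measurable_prodMk_left hB)
    (measurable_prodMk_left hC) (hbd hAb s) (hbd hBb t) (hbd hCb _) fun x hx y hy => ?_
  simpa using H _ hx _ hy

end BrunnMinkowski

theorem brunnMinkowski_volume_pi : ∀ n : ℕ, BrunnMinkowski (volume : Measure (Fin n → ℝ))
  | 0 => by
    have : IsProbabilityMeasure (volume : Measure (Fin 0 → ℝ)) := by
      rw [Measure.volume_pi_eq_dirac]
      infer_instance
    exact .of_subsingleton
  | n + 1 => by
    refine (brunnMinkowski_volume_pi n).prod_real.of_measurePreserving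
      (Fin.consEquivL ℝ fun _ => ℝ) ?_
    have he : ⇑(Fin.consEquivL ℝ fun _ : Fin (n + 1) => ℝ) =
        (MeasurableEquiv.piFinSuccAbove (fun _ : Fin (n + 1) => ℝ) 0).symm := by
      ext p i
      exact congrFun (Fin.insertNth_zero' p.1 p.2).symm i
    rw [he]
    exact (volume_preserving_piFinSuccAbove (fun _ => ℝ) 0).symm

theorem brunnMinkowski_volume_euclideanSpace (n : ℕ) :
    BrunnMinkowski (volume : Measure (EuclideanSpace ℝ (Fin n))) :=
  (brunnMinkowski_volume_pi n).of_measurePreserving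
    (EuclideanSpace.equiv (Fin n) ℝ).symm (PiLp.volume_preserving_toLp (Fin n))

section Overlap

variable {E : Type*} [NormedAddCommGroup E] {U V : Set E}

/-- The set of pairs `(z, x)` with `x ∈ U ∩ (z + V)`. -/
def overlapSet (U V : Set E) : Set (E × E) := {p | p.2 ∈ U ∧ p.2 - p.1 ∈ V}

theorem isOpen_overlapSet (hU : IsOpen U) (hV : IsOpen V) : IsOpen (overlapSet U V) :=
  (hU.preimage continuous_snd).inter (hV.preimage (continuous_snd.sub continuous_fst))

theorem isBounded_overlapSet (hU : Bornology.IsBounded U) (hV : Bornology.IsBounded V) :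
    Bornology.IsBounded (overlapSet U V) :=
  ((hU.sub hV).prod hU).subset fun p hp => ⟨⟨p.2, hp.1, p.2 - p.1, hp.2, by simp⟩, hp.1⟩

variable [MeasurableSpace E] {μ : Measure E}

/-- The measure of `U ∩ (z + V)`. -/
noncomputable def overlap (μ : Measure E) (U V : Set E) (z : E) : ENNReal :=
  μ (Prod.mk z ⁻¹' overlapSet U V)

theorem overlap_ne_top [NormedSpace ℝ E] [FiniteDimensional ℝ E]
    [IsFiniteMeasureOnCompacts μ] (hU : Bornology.IsBounded U) (z : E) : overlap μ U V z ≠ ⊤ :=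
  (hU.subset fun _ hx => hx.1).measure_lt_top.ne

theorem overlap_pos_iff [μ.IsOpenPosMeasure] (hU : IsOpen U) (hV : IsOpen V) {z : E} :
    0 < overlap μ U V z ↔ z ∈ U - V := by
  rw [overlap,
    ((isOpen_overlapSet hU hV).preimage (Continuous.prodMk_right z)).measure_pos_iff (μ := μ)]
  constructor
  · rintro ⟨x, hx⟩
    exact ⟨x, hx.1, x - z, hx.2, by simp⟩
  · rintro ⟨x, hx, y, hy, rfl⟩
    exact ⟨x, hx, by simpa using hy⟩

variable [BorelSpace E]

theorem integral_indicator_overlapSet (hU : IsOpen U) (hV : IsOpen V) (ψ : E → ℝ) (z : E) :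
    ∫ x, (overlapSet U V).indicator (fun p => ψ p.1) (z, x) ∂μ =
      (overlap μ U V z).toReal * ψ z := by
  have : (fun x => (overlapSet U V).indicator (fun p => ψ p.1) (z, x)) =
      (Prod.mk z ⁻¹' overlapSet U V).indicator fun _ => ψ z := rfl
  rw [this, integral_indicator
    ((isOpen_overlapSet hU hV).preimage (Continuous.prodMk_right z)).measurableSet]
  simp [overlap, Measure.real]

variable [NormedSpace ℝ E]

theorem overlap_rpow_mul_le (hμ : BrunnMinkowski μ) (hU : IsOpen U) (hV : IsOpen V)
    (hUc : Convex ℝ U) (hVc : Convex ℝ V) (hUb : Bornology.IsBounded U) {a b : ℝ} (ha : 0 < a)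
    (hb : 0 < b) (hab : a + b = 1) (z w : E) :
    overlap μ U V z ^ a * overlap μ U V w ^ b ≤ overlap μ U V (a • z + b • w) := by
  have hm : ∀ z, MeasurableSet (Prod.mk z ⁻¹' overlapSet U V) := fun z =>
    ((isOpen_overlapSet hU hV).preimage (Continuous.prodMk_right z)).measurableSet
  have hbd : ∀ z, Bornology.IsBounded (Prod.mk z ⁻¹' overlapSet U V) := fun z =>
    hUb.subset fun _ hx => hx.1
  refine hμ ha hb hab (hm _) (hm _) (hm _) (hbd _) (hbd _) (hbd _) fun x hx y hy => ?_
  refine ⟨hUc hx.1 hy.1 ha.le hb.le hab, ?_⟩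
  convert hVc hx.2 hy.2 ha.le hb.le hab using 1
  simp only [smul_sub]
  abel

/-- The open strict hypograph of the logarithm of `overlap`. -/
def overlapLogHypograph (μ : Measure E) (U V : Set E) : Set (E × ℝ) :=
  {p | ENNReal.ofReal (Real.exp p.2) < overlap μ U V p.1}

theorem convex_overlapLogHypograph (hμ : BrunnMinkowski μ) (hU : IsOpen U) (hV : IsOpen V)
    (hUc : Convex ℝ U) (hVc : Convex ℝ V) (hUb : Bornology.IsBounded U) :
    Convex ℝ (overlapLogHypograph μ U V) := by
  refine convex_iff_forall_pos.2 fun p hp q hq a b ha hb hab => ?_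
  refine lt_of_lt_of_le ?_ (overlap_rpow_mul_le hμ hU hV hUc hVc hUb ha hb hab p.1 q.1)
  have : ENNReal.ofReal (Real.exp (a • p + b • q).2) =
      ENNReal.ofReal (Real.exp p.2) ^ a * ENNReal.ofReal (Real.exp q.2) ^ b := by
    rw [ENNReal.ofReal_rpow_of_pos (Real.exp_pos _), ENNReal.ofReal_rpow_of_pos (Real.exp_pos _),
      ← ENNReal.ofReal_mul (by positivity), ← Real.exp_mul, ← Real.exp_mul, ← Real.exp_add]
    simp [mul_comm]
  rw [this]
  exact ENNReal.mul_lt_mul (ENNReal.rpow_lt_rpow hp ha) (ENNReal.rpow_lt_rpow hq hb)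

variable [FiniteDimensional ℝ E] [μ.IsAddHaarMeasure]

theorem lowerSemicontinuous_overlap (hU : IsOpen U) (hV : IsOpen V) :
    LowerSemicontinuous (overlap μ U V) := by
  intro z r hr
  have hS := isOpen_overlapSet hU hV
  obtain ⟨K, hK, hKc, hrK⟩ := (hS.preimage (Continuous.prodMk_right z)).exists_lt_isCompact hr
  obtain ⟨u, v, hu, hv, hzu, hKv, huv⟩ := generalized_tube_lemma (isCompact_singleton (x := z)) hKc
    hS (by rintro ⟨_, x⟩ ⟨rfl, hx⟩; exact hK hx)
  filter_upwards [hu.mem_nhds (hzu rfl)] with w hw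
  exact hrK.trans_le (measure_mono fun x hx => huv ⟨hw, hKv hx⟩)

theorem integrable_indicator_overlapSet (hU : IsOpen U) (hV : IsOpen V)
    (hUb : Bornology.IsBounded U) (hVb : Bornology.IsBounded V) {ψ : E → ℝ} (hψ : Continuous ψ) :
    Integrable ((overlapSet U V).indicator fun p => ψ p.1) (μ.prod μ) := by
  rw [integrable_indicator_iff (isOpen_overlapSet hU hV).measurableSet]
  exact ((hψ.comp continuous_fst).continuousOn.integrableOn_compact
    (isBounded_overlapSet hUb hVb).isCompact_closure).mono_set subset_closure

theorem integrable_overlap_mul (hU : IsOpen U) (hV : IsOpen V)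
    (hUb : Bornology.IsBounded U) (hVb : Bornology.IsBounded V) {ψ : E → ℝ} (hψ : Continuous ψ) :
    Integrable (fun z => (overlap μ U V z).toReal * ψ z) μ := by
  simpa only [integral_indicator_overlapSet hU hV] using
    (integrable_indicator_overlapSet (μ := μ) hU hV hUb hVb hψ).integral_prod_left

theorem integral_overlap_mul (hU : IsOpen U) (hV : IsOpen V)
    (hUb : Bornology.IsBounded U) (hVb : Bornology.IsBounded V) {ψ : E → ℝ} (hψ : Continuous ψ) :
    ∫ z, (overlap μ U V z).toReal * ψ z ∂μ = ∫ x in U, ∫ y in V, ψ (x - y) ∂μ ∂μ := by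
  simp only [← integral_indicator_overlapSet hU hV]
  rw [integral_integral_swap (f := fun z x => (overlapSet U V).indicator (fun p => ψ p.1) (z, x))
    (integrable_indicator_overlapSet hU hV hUb hVb hψ), ← integral_indicator hU.measurableSet]
  congr with x
  by_cases hx : x ∈ U
  · rw [Set.indicator_of_mem hx, ← integral_indicator hV.measurableSet,
      ← integral_sub_left_eq_self _ μ x]
    congr with y
    by_cases hy : y ∈ V <;> simp [Set.indicator, overlapSet, hx, hy]
  · simp [Set.indicator, overlapSet, hx]

theorem integral_integral_continuousLinearMap_sub_eq_zero (hUb : Bornology.IsBounded U)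
    (hVb : Bornology.IsBounded V)
    (hcent : (μ U).toReal⁻¹ • ∫ x in U, x ∂μ = (μ V).toReal⁻¹ • ∫ x in V, x ∂μ)
    (hU0 : μ U ≠ 0) (hV0 : μ V ≠ 0) (ℓ : E →L[ℝ] ℝ) :
    ∫ x in U, ∫ y in V, ℓ (x - y) ∂μ ∂μ = 0 := by
  have hUt := hUb.measure_lt_top (μ := μ)
  have hVt := hVb.measure_lt_top (μ := μ)
  have hi : ∀ {S : Set E}, Bornology.IsBounded S → IntegrableOn (fun x : E => x) S μ := fun hS =>
    (continuousOn_id.integrableOn_compact hS.isCompact_closure).mono_set subset_closure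
  have hiℓ : ∀ {S : Set E}, Bornology.IsBounded S → IntegrableOn (fun x : E => ℓ x) S μ :=
    fun hS => ℓ.integrable_comp (hi hS)
  have hu : (μ U).toReal ≠ 0 := ENNReal.toReal_ne_zero.2 ⟨hU0, hUt.ne⟩
  have hv : (μ V).toReal ≠ 0 := ENNReal.toReal_ne_zero.2 ⟨hV0, hVt.ne⟩
  have hc := congrArg ℓ hcent
  rw [map_smul, map_smul, ← ℓ.integral_comp_comm (hi hUb), ← ℓ.integral_comp_comm (hi hVb),
    smul_eq_mul, smul_eq_mul] at hc
  have hcU : ∀ c : ℝ, IntegrableOn (fun _ : E => c) U μ := fun c => integrableOn_const hUt.ne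
  have hcV : ∀ c : ℝ, IntegrableOn (fun _ : E => c) V μ := fun c => integrableOn_const hVt.ne
  have hin : ∀ x, ∫ y in V, ℓ (x - y) ∂μ = (μ V).toReal * ℓ x - ∫ y in V, ℓ y ∂μ := by
    intro x
    simp only [map_sub]
    rw [integral_sub (hcV _) (hiℓ hVb)]
    simp [Measure.real]
  simp only [hin]
  rw [integral_sub ((hiℓ hUb).const_mul _) (hcU _), integral_const_mul]
  simp only [integral_const, measureReal_restrict_apply_univ, smul_eq_mul]
  simp only [Measure.real]
  field_simp at hc
  linarith

theorem isOpen_overlapLogHypograph (hU : IsOpen U) (hV : IsOpen V) :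
    IsOpen (overlapLogHypograph μ U V) := by
  refine isOpen_iff_mem_nhds.2 fun p hp => ?_
  obtain ⟨r, hr1, hr2⟩ := exists_between
    (show ENNReal.ofReal (Real.exp p.2) < overlap μ U V p.1 from hp)
  have h1 : ContinuousAt (fun p : E × ℝ => ENNReal.ofReal (Real.exp p.2)) p :=
    (ENNReal.continuous_ofReal.comp (by fun_prop)).continuousAt
  filter_upwards [h1.eventually_lt_const hr1,
    continuous_fst.continuousAt.eventually (lowerSemicontinuous_overlap hU hV p.1 r hr2)]
    with q hq1 hq2 using lt_trans hq1 hq2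

/-- When `U` and `V` have the same centroid, the overlap function is dominated by `c * exp (-ℓ)`
for some linear functional `ℓ`, for every `c` at least its value at the origin. -/
theorem exists_log_overlap_add_le (hμ : BrunnMinkowski μ) (hU : IsOpen U) (hV : IsOpen V)
    (hUc : Convex ℝ U) (hVc : Convex ℝ V) (hUb : Bornology.IsBounded U)
    (hVb : Bornology.IsBounded V) (hU0 : U.Nonempty) (hV0 : V.Nonempty)
    (hcent : (μ U).toReal⁻¹ • ∫ x in U, x ∂μ = (μ V).toReal⁻¹ • ∫ x in V, x ∂μ)
    {c : ℝ} (hc0 : 0 < c) (hc : overlap μ U V 0 ≤ ENNReal.ofReal c) :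
    ∃ ℓ : E →L[ℝ] ℝ, ∀ z ∈ U - V, Real.log (overlap μ U V z).toReal + ℓ z ≤ Real.log c := by
  have hnot : ((0, Real.log c) : E × ℝ) ∉ overlapLogHypograph μ U V := by
    simpa [overlapLogHypograph, Real.exp_log hc0] using hc
  obtain ⟨m, hm⟩ : ∃ m : E × ℝ →L[ℝ] ℝ,
      ∀ p ∈ overlapLogHypograph μ U V, m p < m (0, Real.log c) :=
    geometric_hahn_banach_open_point (convex_overlapLogHypograph hμ hU hV hUc hVc hUb)
      (isOpen_overlapLogHypograph hU hV) hnot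
  set ℓ : E →L[ℝ] ℝ := m.comp (.inl ℝ E ℝ) with hℓ
  set α : ℝ := m (0, 1) with hα
  have hmz : ∀ z t, m (z, t) = ℓ z + t * α := by
    intro z t
    have : (z, t) = (z, 0) + t • ((0 : E), (1 : ℝ)) := by simp
    rw [this, map_add, map_smul]
    simp [hℓ, hα]
  have hpos : ∀ z ∈ U - V, 0 < (overlap μ U V z).toReal := fun z hz =>
    ENNReal.toReal_pos ((overlap_pos_iff hU hV).2 hz).ne' (overlap_ne_top hUb z)
  have hsep : ∀ z ∈ U - V, ∀ t < Real.log (overlap μ U V z).toReal,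
      ℓ z + t * α < Real.log c * α := by
    intro z hz t ht
    have := hm (z, t) (by
      refine (ENNReal.ofReal_lt_iff_lt_toReal (Real.exp_pos t).le (overlap_ne_top hUb z)).2 ?_
      exact (Real.lt_log_iff_exp_lt (hpos z hz)).1 ht)
    simpa [hmz] using this
  have hD0 := hU0.sub hV0
  obtain hα0 | hα0 | hα0 := lt_trichotomy α 0
  · obtain ⟨z, hz⟩ := hD0
    obtain ⟨t, ht1, ht2⟩ : ∃ t, t < Real.log (overlap μ U V z).toReal ∧
        t ≤ (Real.log c * α - ℓ z) / α :=
      ⟨min (Real.log (overlap μ U V z).toReal - 1) _,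
        (min_le_left _ _).trans_lt (sub_one_lt _), min_le_right _ _⟩
    have h1 := hsep z hz t ht1
    have h2 := (le_div_iff_of_neg hα0).1 ht2
    linarith
  · -- A vertical separating hyperplane contradicts the vanishing first moment of the overlap.
    have hneg : ∀ z ∈ U - V, ℓ z < 0 := by
      intro z hz
      simpa [hα0] using hsep z hz _ (sub_one_lt _)
    have hcont : Continuous fun z => (-ℓ) z := (-ℓ).continuous
    have h0 := integral_overlap_mul (μ := μ) hU hV hUb hVb hcont
    rw [integral_integral_continuousLinearMap_sub_eq_zero hUb hVb hcent
      (hU.measure_pos μ hU0).ne' (hV.measure_pos μ hV0).ne' (-ℓ)] at h0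
    have hposD : ∀ z ∈ U - V, 0 < (overlap μ U V z).toReal * (-ℓ) z := fun z hz =>
      mul_pos (hpos z hz) (by simpa using hneg z hz)
    have hnn : ∀ z, 0 ≤ (overlap μ U V z).toReal * (-ℓ) z := by
      intro z
      by_cases hz : z ∈ U - V
      · exact (hposD z hz).le
      · simp [show overlap μ U V z = 0 by
          simpa using mt (overlap_pos_iff (μ := μ) hU hV).1 hz]
    refine absurd h0 (ne_of_gt ?_)
    refine (integral_pos_iff_support_of_nonneg hnn
      (integrable_overlap_mul hU hV hUb hVb hcont)).2 ?_
    exact (hU.sub_right.measure_pos μ hD0).trans_le (measure_mono fun z hz => (hposD z hz).ne')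
  · refine ⟨α⁻¹ • ℓ, fun z hz => ?_⟩
    refine le_of_forall_lt fun s hs => ?_
    have := hsep z hz (s - α⁻¹ * ℓ z) (by simp at hs; linarith)
    have h2 : ℓ z + (s - α⁻¹ * ℓ z) * α = s * α := by field_simp; ring
    rw [h2] at this
    exact lt_of_mul_lt_mul_right this hα0.le

/-- The Milman–Pajor inequality for bounded open convex sets. -/
theorem milmanPajor_of_isOpen (hμ : BrunnMinkowski μ) (hU : IsOpen U) (hV : IsOpen V)
    (hUc : Convex ℝ U) (hVc : Convex ℝ V) (hUb : Bornology.IsBounded U)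
    (hVb : Bornology.IsBounded V) (hU0 : U.Nonempty) (hV0 : V.Nonempty)
    (hcent : (μ U).toReal⁻¹ • ∫ x in U, x ∂μ = (μ V).toReal⁻¹ • ∫ x in V, x ∂μ) :
    μ U * μ V ≤ μ (U - V) * μ (U ∩ V) := by
  have hD0 := hU0.sub hV0
  have hD : IsOpen (U - V) := hU.sub_right
  have hUt := hUb.measure_lt_top (μ := μ)
  have hVt := hVb.measure_lt_top (μ := μ)
  have hDt := (hUb.sub hVb).measure_lt_top (μ := μ)
  have hover : overlap μ U V 0 = μ (U ∩ V) := by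
    rw [overlap]
    congr 1
    ext x
    simp [overlapSet]
  have hItop := overlap_ne_top (μ := μ) (V := V) hUb 0
  have hu := ENNReal.toReal_pos (hU.measure_pos μ hU0).ne' hUt.ne
  have hv := ENNReal.toReal_pos (hV.measure_pos μ hV0).ne' hVt.ne
  have hd := ENNReal.toReal_pos (hD.measure_pos μ hD0).ne' hDt.ne
  rw [← hover, ← ENNReal.toReal_le_toReal (ENNReal.mul_ne_top hUt.ne hVt.ne)
    (ENNReal.mul_ne_top hDt.ne hItop), ENNReal.toReal_mul, ENNReal.toReal_mul]
  by_contra! hlt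
  set c := (μ U).toReal * (μ V).toReal / (μ (U - V)).toReal with hc
  have hc0 : 0 < c := by positivity
  obtain ⟨c', hc'_gt, hc'_lt⟩ := exists_between ((lt_div_iff₀' hd).2 hlt)
  have hc'_pos : 0 < c' := ENNReal.toReal_nonneg.trans_lt hc'_gt
  obtain ⟨ℓ, hℓ⟩ := exists_log_overlap_add_le hμ hU hV hUc hVc hUb hVb hU0 hV0 hcent hc'_pos
    ((ENNReal.le_ofReal_iff_toReal_le hItop hc'_pos.le).2 hc'_gt.le)
  set k := 1 + Real.log c - Real.log c' with hk
  have hle : ∀ z, (overlap μ U V z).toReal * (k + ℓ z) ≤ (U - V).indicator (fun _ => c) z := by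
    intro z
    by_cases hz : z ∈ U - V
    · have hp := ENNReal.toReal_pos ((overlap_pos_iff (μ := μ) hU hV).2 hz).ne'
        (overlap_ne_top hUb z)
      have h1 := hℓ z hz
      have h2 := Real.log_le_sub_one_of_pos (div_pos hc0 hp)
      rw [Real.log_div hc0.ne' hp.ne'] at h2
      rw [Set.indicator_of_mem hz, ← le_div_iff₀' hp]
      linarith
    · simp [hz, show overlap μ U V z = 0 by
        simpa using mt (overlap_pos_iff (μ := μ) hU hV).1 hz]
  have hmono := integral_mono (μ := μ)
    (integrable_overlap_mul (ψ := fun z => k + ℓ z) hU hV hUb hVb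
      (continuous_const.add ℓ.continuous))
    ((integrable_indicator_iff hD.measurableSet).2 (integrableOn_const hDt.ne)) hle
  have hsplit : ∫ z, (overlap μ U V z).toReal * (k + ℓ z) ∂μ =
      k * ((μ U).toReal * (μ V).toReal) := by
    simp only [mul_add]
    rw [integral_add (integrable_overlap_mul hU hV hUb hVb continuous_const)
      (integrable_overlap_mul hU hV hUb hVb ℓ.continuous),
      integral_overlap_mul hU hV hUb hVb continuous_const,
      integral_overlap_mul hU hV hUb hVb ℓ.continuous,
      integral_integral_continuousLinearMap_sub_eq_zero hUb hVb hcent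
      (hU.measure_pos μ hU0).ne' (hV.measure_pos μ hV0).ne']
    simp [Measure.real]
    ring
  have hlog := Real.log_lt_log hc'_pos hc'_lt
  rw [hsplit, integral_indicator hD.measurableSet, setIntegral_const, smul_eq_mul, Measure.real,
    hc, mul_div_cancel₀ _ hd.ne'] at hmono
  have : k ≤ 1 := le_of_mul_le_mul_right (by simpa using hmono) (mul_pos hu hv)
  linarith

end Overlap

/-- Milman–Pajor inequality: if `K` and `L` are convex bodies in `ℝ^n` with the same
centroid, then `vol(K)·vol(L) ≤ vol(K − L)·vol(K ∩ L)`. -/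
theorem stmt_10 (n : ℕ) (K L : Set (EuclideanSpace ℝ (Fin n)))
    (hKc : Convex ℝ K) (hKcp : IsCompact K) (hKne : (interior K).Nonempty)
    (hLc : Convex ℝ L) (hLcp : IsCompact L) (hLne : (interior L).Nonempty)
    (hcent : (volume K).toReal⁻¹ • ∫ x in K, x =
      (volume L).toReal⁻¹ • ∫ x in L, x) :
    volume K * volume L ≤ volume (K - L) * volume (K ∩ L) := by
  have hK := interior_ae_eq_of_null_frontier (hKc.addHaar_frontier volume)
  have hL := interior_ae_eq_of_null_frontier (hLc.addHaar_frontier volume)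
  rw [← measure_congr hK, ← measure_congr hL, ← setIntegral_congr_set hK,
    ← setIntegral_congr_set hL] at hcent
  rw [← measure_congr hK, ← measure_congr hL]
  calc volume (interior K) * volume (interior L)
      ≤ volume (interior K - interior L) * volume (interior K ∩ interior L) :=
        milmanPajor_of_isOpen (brunnMinkowski_volume_euclideanSpace n) isOpen_interior
          isOpen_interior hKc.interior hLc.interior (hKcp.isBounded.subset interior_subset)
          (hLcp.isBounded.subset interior_subset) hKne hLne hcent
    _ ≤ volume (K - L) * volume (K ∩ L) :=
        mul_le_mul' (measure_mono (Set.sub_subset_sub interior_subset interior_subset))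
          (measure_mono (Set.inter_subset_inter interior_subset interior_subset))
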